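/- arXiv:2208.10080 — 7 statements merged into one kernel-verified Lean document; each statement's English description precedes it below -/
import Mathlib

section
/- Let X be a nonempty w-invex subset of ℝⁿ with respect to η and w, let h : X → ℝ be w-preinvex with respect to η and w, and let ν = inf_{z∈X} h(z) (assumed attained, i.e., the set F below is nonempty). Then the set F = {z ∈ X : h(z) = ν} is w-invex with respect to the same η and w. -/
/-- the set of minimizers F = {z ∈ X : h z = ν} of a
w-preinvex function, where ν = inf_{z∈X} h z, is w-invex. -/
theorem argmin_w_invex_of_w_preinvex {n : ℕ}
    (X : Set (Fin n → ℝ)) (hX : X.Nonempty)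
    (η : (Fin n → ℝ) → (Fin n → ℝ) → (Fin n → ℝ)) (w : (Fin n → ℝ) → (Fin n → ℝ))
    (hXinvex : ∀ z₁ ∈ X, ∀ z₂ ∈ X, ∀ δ ∈ Set.Icc (0:ℝ) 1,
      w z₂ + δ • η z₁ (w z₂) ∈ X)
    (h : (Fin n → ℝ) → ℝ)
    (hpre : ∀ z₁ ∈ X, ∀ z₂ ∈ X, ∀ δ ∈ Set.Icc (0:ℝ) 1,
      h (w z₂ + δ • η z₁ (w z₂)) ≤ δ * h z₁ + (1 - δ) * h z₂)
    (ν : ℝ) (hν : IsGLB (h '' X) ν)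
    (hF : {z ∈ X | h z = ν}.Nonempty) :
    ∀ z₁ ∈ {z ∈ X | h z = ν}, ∀ z₂ ∈ {z ∈ X | h z = ν},
      ∀ δ ∈ Set.Icc (0:ℝ) 1, w z₂ + δ • η z₁ (w z₂) ∈ {z ∈ X | h z = ν} := by
  rintro z₁ ⟨hz₁, e₁⟩ z₂ ⟨hz₂, e₂⟩ δ hδ
  have hm := hXinvex z₁ hz₁ z₂ hz₂ δ hδ
  refine ⟨hm, le_antisymm ?_ (hν.1 ⟨_, hm, rfl⟩)⟩
  have hp := hpre z₁ hz₁ z₂ hz₂ δ hδ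
  rw [e₁, e₂] at hp
  linarith
end

section
/- Let X be a nonempty w-invex subset of ℝⁿ with respect to η and w, let h : X → ℝ be w-strictly preinvex with respect to η and w, and let ν = inf_{z∈X} h(z). Then the set F = {z ∈ X : h(z) = ν} contains at most one point, i.e., if z₁, z₂ ∈ X satisfy h(z₁) = h(z₂) = ν then z₁ = z₂. -/
/-- for a w-strictly preinvex function, the set of minimizers
F = {z ∈ X : h z = ν}, where ν = inf_{z∈X} h z, has at most one point. -/
theorem argmin_subsingleton_of_w_strictly_preinvex {n : ℕ}
    (X : Set (Fin n → ℝ)) (hX : X.Nonempty)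
    (η : (Fin n → ℝ) → (Fin n → ℝ) → (Fin n → ℝ)) (w : (Fin n → ℝ) → (Fin n → ℝ))
    (hXinvex : ∀ z₁ ∈ X, ∀ z₂ ∈ X, ∀ δ ∈ Set.Icc (0:ℝ) 1,
      w z₂ + δ • η z₁ (w z₂) ∈ X)
    (h : (Fin n → ℝ) → ℝ)
    (hstrict : ∀ z₁ ∈ X, ∀ z₂ ∈ X, z₁ ≠ z₂ → ∀ δ ∈ Set.Ioo (0:ℝ) 1,
      h (w z₂ + δ • η z₁ (w z₂)) < δ * h z₁ + (1 - δ) * h z₂)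
    (ν : ℝ) (hν : IsGLB (h '' X) ν) :
    ∀ z₁ ∈ X, ∀ z₂ ∈ X, h z₁ = ν → h z₂ = ν → z₁ = z₂ := by
  intro z₁ m₁ z₂ m₂ e₁ e₂
  by_contra hne
  have a := hstrict z₁ m₁ z₂ m₂ hne (1/2) ⟨by norm_num, by norm_num⟩
  have b := hν.1 (Set.mem_image_of_mem h (hXinvex z₁ m₁ z₂ m₂ (1/2) ⟨by norm_num, by norm_num⟩))
  rw [e₁, e₂] at a
  linarith
end

section
/- Let X be a nonempty w-invex subset of ℝⁿ with respect to η and w, and let h : X → ℝ be w-preinvex with respect to η and w. Assume additionally that for every z₂ ∈ X and every z₁ ∈ X, the points w(z₂) + δ·η(z₁, w(z₂)) converge to z₂ as δ → 0⁺ (so that these points eventually lie in any neighborhood of z₂). Then every local minimum point of h on X is a global minimum point of h on X; that is, if z₂ ∈ X and there is a neighborhood N of z₂ with h(z) ≥ h(z₂) for all z ∈ N ∩ X, then h(z) ≥ h(z₂) for all z ∈ X. -/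
/-- for a w-preinvex function (with the path-continuity
assumption), every local minimum on X is a global minimum on X. -/
theorem local_min_is_global_min_of_w_preinvex {n : ℕ}
    (X : Set (Fin n → ℝ)) (hX : X.Nonempty)
    (η : (Fin n → ℝ) → (Fin n → ℝ) → (Fin n → ℝ)) (w : (Fin n → ℝ) → (Fin n → ℝ))
    (hXinvex : ∀ z₁ ∈ X, ∀ z₂ ∈ X, ∀ δ ∈ Set.Icc (0:ℝ) 1,
      w z₂ + δ • η z₁ (w z₂) ∈ X)
    (h : (Fin n → ℝ) → ℝ)
    (hpre : ∀ z₁ ∈ X, ∀ z₂ ∈ X, ∀ δ ∈ Set.Icc (0:ℝ) 1,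
      h (w z₂ + δ • η z₁ (w z₂)) ≤ δ * h z₁ + (1 - δ) * h z₂)
    (hconv : ∀ z₁ ∈ X, ∀ z₂ ∈ X,
      Filter.Tendsto (fun δ : ℝ => w z₂ + δ • η z₁ (w z₂))
        (nhdsWithin 0 (Set.Ioi 0)) (nhds z₂))
    (z₂ : Fin n → ℝ) (hz₂ : z₂ ∈ X)
    (hloc : ∃ N ∈ nhds z₂, ∀ z ∈ N ∩ X, h z₂ ≤ h z) :
    ∀ z ∈ X, h z₂ ≤ h z := by
  obtain ⟨N, hN, hmin⟩ := hloc
  intro z hz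
  have h1 : ∀ᶠ δ : ℝ in nhdsWithin 0 (Set.Ioi 0), w z₂ + δ • η z (w z₂) ∈ N :=
    (hconv z hz z₂ hz₂) hN
  have h2 : ∀ᶠ δ : ℝ in nhdsWithin 0 (Set.Ioi 0), δ ∈ Set.Ioo (0:ℝ) 1 :=
    Ioo_mem_nhdsGT one_pos
  obtain ⟨δ, hδN, hδ0, hδ1⟩ := (h1.and h2).exists
  have hδ : δ ∈ Set.Icc (0:ℝ) 1 := ⟨hδ0.le, hδ1.le⟩
  have h3 := hmin _ ⟨hδN, hXinvex z hz z₂ hz₂ δ hδ⟩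
  have h4 := hpre z hz z₂ hz₂ δ hδ
  have h5 : δ * h z₂ ≤ δ * h z := by linarith
  exact le_of_mul_le_mul_left h5 hδ0
end

section
/- Let X be a nonempty w-invex subset of ℝⁿ with respect to η and w, and let h : X → ℝ be w-pre pseudo-invex with respect to η and w. Assume additionally that for every z₂ ∈ X and every z₁ ∈ X, the points w(z₂) + δ·η(z₁, w(z₂)) converge to z₂ as δ → 0⁺. Then every local minimum point of h on X is a global minimum point of h on X. -/
/-- for a w-pre pseudo-invex function (with the
path-continuity assumption), every local minimum on X is a global minimum. -/
theorem local_min_is_global_min_of_w_pre_pseudo_invex {n : ℕ}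
    (X : Set (Fin n → ℝ)) (hX : X.Nonempty)
    (η : (Fin n → ℝ) → (Fin n → ℝ) → (Fin n → ℝ)) (w : (Fin n → ℝ) → (Fin n → ℝ))
    (hXinvex : ∀ z₁ ∈ X, ∀ z₂ ∈ X, ∀ δ ∈ Set.Icc (0:ℝ) 1,
      w z₂ + δ • η z₁ (w z₂) ∈ X)
    (h : (Fin n → ℝ) → ℝ)
    (hpseudo : ∃ b : (Fin n → ℝ) → (Fin n → ℝ) → ℝ,
      (∀ z₁ ∈ X, ∀ z₂ ∈ X, h z₁ < h z₂ → 0 < b z₁ z₂) ∧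
      (∀ z₁ ∈ X, ∀ z₂ ∈ X, h z₁ < h z₂ → ∀ δ ∈ Set.Ioo (0:ℝ) 1,
        h (w z₂ + δ • η z₁ (w z₂)) ≤ h z₂ + δ * (δ - 1) * b z₁ z₂))
    (hconv : ∀ z₁ ∈ X, ∀ z₂ ∈ X,
      Filter.Tendsto (fun δ : ℝ => w z₂ + δ • η z₁ (w z₂))
        (nhdsWithin 0 (Set.Ioi 0)) (nhds z₂))
    (z₂ : Fin n → ℝ) (hz₂ : z₂ ∈ X)
    (hloc : ∃ N ∈ nhds z₂, ∀ z ∈ N ∩ X, h z₂ ≤ h z) :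
    ∀ z ∈ X, h z₂ ≤ h z := by
  intro z hz
  by_contra hlt
  push Not at hlt
  obtain ⟨b, hb, hp⟩ := hpseudo
  obtain ⟨N, hN, hmin⟩ := hloc
  have h1 := (hconv z hz z₂ hz₂).eventually hN
  have h2 : ∀ᶠ δ in nhdsWithin (0:ℝ) (Set.Ioi 0), δ ∈ Set.Ioo (0:ℝ) 1 :=
    Ioo_mem_nhdsGT one_pos
  obtain ⟨δ, hδN, hδ⟩ := (h1.and h2).exists
  have h3 := hmin _ ⟨hδN, hXinvex z hz z₂ hz₂ δ ⟨hδ.1.le, hδ.2.le⟩⟩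
  have h4 := hp z hz z₂ hz₂ hlt δ hδ
  have h5 : 0 < δ * (1 - δ) * b z z₂ :=
    mul_pos (mul_pos hδ.1 (sub_pos.2 hδ.2)) (hb z hz z₂ hz₂ hlt)
  nlinarith
end

section
/- Let X be a nonempty w-invex subset of ℝⁿ with respect to η and w, and let h : X → ℝ be w-quasi preinvex with respect to η and w. Suppose z₂ ∈ X is a strict local minimum of h on X, assume additionally that for every z₁ ∈ X the points w(z₂) + δ·η(z₁, w(z₂)) converge to z₂ as δ → 0⁺, and that η(z₁, w(z₂)) ≠ 0 whenever z₁ ≠ w(z₂). Then z₂ is a strict global minimum of h on X: there is no z ∈ X with h(z) < h(z₂). -/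
/-- for a w-quasi preinvex function, a strict local minimum
(with the extra path-continuity and nondegeneracy assumptions) is a strict
global minimum: no point of X has a strictly smaller value. -/
theorem strict_local_min_is_strict_global_min_of_w_quasi_preinvex {n : ℕ}
    (X : Set (Fin n → ℝ)) (hX : X.Nonempty)
    (η : (Fin n → ℝ) → (Fin n → ℝ) → (Fin n → ℝ)) (w : (Fin n → ℝ) → (Fin n → ℝ))
    (hXinvex : ∀ z₁ ∈ X, ∀ z₂ ∈ X, ∀ δ ∈ Set.Icc (0:ℝ) 1,
      w z₂ + δ • η z₁ (w z₂) ∈ X)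
    (h : (Fin n → ℝ) → ℝ)
    (hquasi : ∀ z₁ ∈ X, ∀ z₂ ∈ X, ∀ δ ∈ Set.Icc (0:ℝ) 1,
      h (w z₂ + δ • η z₁ (w z₂)) ≤ max (h z₁) (h z₂))
    (z₂ : Fin n → ℝ) (hz₂ : z₂ ∈ X)
    (hloc : ∃ N ∈ nhds z₂, ∀ z ∈ N ∩ X, z ≠ z₂ → h z₂ < h z)
    (hconv : ∀ z₁ ∈ X,
      Filter.Tendsto (fun δ : ℝ => w z₂ + δ • η z₁ (w z₂))
        (nhdsWithin 0 (Set.Ioi 0)) (nhds z₂))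
    (hη : ∀ z₁ ∈ X, z₁ ≠ w z₂ → η z₁ (w z₂) ≠ 0) :
    ¬ ∃ z ∈ X, h z < h z₂ := by
  rintro ⟨z, hz, hlt⟩
  obtain ⟨N, hN, hmin⟩ := hloc
  have hc : Filter.Tendsto (fun δ : ℝ => w z₂ + δ • η z (w z₂))
      (nhdsWithin 0 (Set.Ioi 0)) (nhds (w z₂)) := by
    have hcont : Continuous (fun δ : ℝ => w z₂ + δ • η z (w z₂)) := by fun_prop
    have h0 := hcont.tendsto 0
    simp only [zero_smul, add_zero] at h0
    exact h0.mono_left nhdsWithin_le_nhds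
  have hw : w z₂ = z₂ := tendsto_nhds_unique hc (hconv z hz)
  have hne : z ≠ w z₂ := by
    intro he
    rw [hw] at he
    rw [he] at hlt
    exact lt_irrefl _ hlt
  have hη0 := hη z hz hne
  have h1 : ∀ᶠ δ : ℝ in nhdsWithin 0 (Set.Ioi 0), δ ∈ Set.Ioo (0:ℝ) 1 :=
    Ioo_mem_nhdsGT one_pos
  obtain ⟨δ, hδN, hδ⟩ := (((hconv z hz).eventually hN).and h1).exists
  have hδ' : δ ∈ Set.Icc (0:ℝ) 1 := ⟨hδ.1.le, hδ.2.le⟩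
  have hlt2 := hmin _ ⟨hδN, hXinvex z hz z₂ hz₂ δ hδ'⟩ (by
    intro he
    have h3 : δ • η z (w z₂) = 0 := by
      have h4 : w z₂ + δ • η z (w z₂) = w z₂ := he.trans hw.symm
      simpa only [add_eq_left] using h4
    exact (smul_ne_zero hδ.1.ne' hη0) h3)
  have hle := hquasi z hz z₂ hz₂ δ hδ'
  rw [max_eq_right hlt.le] at hle
  exact absurd hlt2 (not_lt.mpr hle)
end

section
/- Let X be a nonempty w-invex subset of ℝⁿ with respect to η and w, and let h : X → ℝ be w-strictly preinvex with respect to η and w. Then the global optimal solution of the problem of minimizing h over X is unique: if z₁, z₂ ∈ X both satisfy h(z₁) ≤ h(z) and h(z₂) ≤ h(z) for all z ∈ X, then z₁ = z₂. -/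
/-- a w-strictly preinvex function has at most one global
minimizer over X. -/
theorem global_min_unique_of_w_strictly_preinvex {n : ℕ}
    (X : Set (Fin n → ℝ)) (hX : X.Nonempty)
    (η : (Fin n → ℝ) → (Fin n → ℝ) → (Fin n → ℝ)) (w : (Fin n → ℝ) → (Fin n → ℝ))
    (hXinvex : ∀ z₁ ∈ X, ∀ z₂ ∈ X, ∀ δ ∈ Set.Icc (0:ℝ) 1,
      w z₂ + δ • η z₁ (w z₂) ∈ X)
    (h : (Fin n → ℝ) → ℝ)
    (hstrict : ∀ z₁ ∈ X, ∀ z₂ ∈ X, z₁ ≠ z₂ → ∀ δ ∈ Set.Ioo (0:ℝ) 1,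
      h (w z₂ + δ • η z₁ (w z₂)) < δ * h z₁ + (1 - δ) * h z₂)
    (z₁ : Fin n → ℝ) (hz₁ : z₁ ∈ X) (z₂ : Fin n → ℝ) (hz₂ : z₂ ∈ X)
    (hopt₁ : ∀ z ∈ X, h z₁ ≤ h z) (hopt₂ : ∀ z ∈ X, h z₂ ≤ h z) :
    z₁ = z₂ := by
  by_contra hne
  have a := hstrict z₁ hz₁ z₂ hz₂ hne (1 / 2) ⟨by norm_num, by norm_num⟩
  have m := hXinvex z₁ hz₁ z₂ hz₂ (1 / 2) ⟨by norm_num, by norm_num⟩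
  have b := hopt₁ _ m
  have c := hopt₂ _ m
  linarith
end

section
/- Let X be a nonempty w-invex subset of ℝⁿ with respect to η and w, let h : X → ℝ be w-strictly quasi preinvex with respect to η and w, and suppose the minimum γ = min_{z∈X} h(z) is attained. Then the set Y = {z ∈ X : h(z) = γ} of optimal solutions is a singleton: if z₁, z₂ ∈ X satisfy h(z₁) = h(z₂) = γ, then z₁ = z₂. -/
/-- for a w-strictly quasi preinvex function whose minimum γ
over X is attained, the set of optimal solutions is a singleton. -/
theorem optimal_set_singleton_of_w_strictly_quasi_preinvex {n : ℕ}
    (X : Set (Fin n → ℝ)) (hX : X.Nonempty)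
    (η : (Fin n → ℝ) → (Fin n → ℝ) → (Fin n → ℝ)) (w : (Fin n → ℝ) → (Fin n → ℝ))
    (hXinvex : ∀ z₁ ∈ X, ∀ z₂ ∈ X, ∀ δ ∈ Set.Icc (0:ℝ) 1,
      w z₂ + δ • η z₁ (w z₂) ∈ X)
    (h : (Fin n → ℝ) → ℝ)
    (hstrictquasi : ∀ z₁ ∈ X, ∀ z₂ ∈ X, z₁ ≠ z₂ → ∀ δ ∈ Set.Ioo (0:ℝ) 1,
      h (w z₂ + δ • η z₁ (w z₂)) < max (h z₁) (h z₂))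
    (γ : ℝ) (hattained : ∃ z₀ ∈ X, h z₀ = γ) (hmin : ∀ z ∈ X, γ ≤ h z) :
    ∀ z₁ ∈ X, ∀ z₂ ∈ X, h z₁ = γ → h z₂ = γ → z₁ = z₂ := by
  intro z₁ h₁ z₂ h₂ e₁ e₂
  by_contra hne
  have hlt := hstrictquasi z₁ h₁ z₂ h₂ hne (1/2) ⟨by norm_num, by norm_num⟩
  have hge := hmin _ (hXinvex z₁ h₁ z₂ h₂ (1/2) ⟨by norm_num, by norm_num⟩)
  rw [e₁, e₂, max_self] at hlt
  exact absurd hlt (not_lt.mpr hge)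
end
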